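/- Let I ⊂ S = K[x_1,…,x_n] be a nonzero proper monomial ideal. Then sdepth_S(S/I) = n − 1 if and only if I is a principal ideal. -/

import Mathlib

open MvPolynomial

/-- The `K`-subspace `m·K[Z]` of `S = K[x_0,…,x_{n-1}]`, where `m` is the monomial with
exponent vector `a` and `Z` is a set of variables: the span of all monomials `m·w`
with `w` a monomial in the variables of `Z`. -/
noncomputable def StanleySpace (K : Type*) [Field K] {n : ℕ} (a : Fin n →₀ ℕ)
    (Z : Finset (Fin n)) : Submodule K (MvPolynomial (Fin n) K) :=
  Submodule.span K
    {p | ∃ c : Fin n →₀ ℕ, c.support ⊆ Z ∧ p = monomial (a + c) (1 : K)}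

/-- `I` is a monomial ideal, i.e. an ideal generated by monomials. -/
def IsMonomialIdeal {K : Type*} [Field K] {n : ℕ}
    (I : Ideal (MvPolynomial (Fin n) K)) : Prop :=
  ∃ G : Set (Fin n →₀ ℕ), I = Ideal.span ((fun a => monomial a (1 : K)) '' G)

/-- The `K`-subspace of `S` spanned by the monomials lying in `I` but not in `J`.
For monomial ideals `J ⊆ I` this is the canonical `K`-vector space representative
of the `ℤⁿ`-graded module `I/J` inside `S`. -/
noncomputable def monomialSpan (K : Type*) [Field K] {n : ℕ}
    (I J : Ideal (MvPolynomial (Fin n) K)) : Submodule K (MvPolynomial (Fin n) K) :=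
  Submodule.span K
    {p | ∃ a : Fin n →₀ ℕ, p = monomial a (1 : K) ∧
      monomial a (1 : K) ∈ I ∧ monomial a (1 : K) ∉ J}

/-- The family `(a i, Z i), i = 1,…,r` is a Stanley decomposition of the module `I/J`
(represented by the span of the monomials of `I \ J`): the Stanley spaces
`(a i)·K[Z i]` are independent and their (direct) sum is all of `I/J`. -/
def IsStanleyDecomp (K : Type*) [Field K] {n r : ℕ}
    (I J : Ideal (MvPolynomial (Fin n) K))
    (a : Fin r → (Fin n →₀ ℕ)) (Z : Fin r → Finset (Fin n)) : Prop :=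
  iSupIndep (fun i => StanleySpace K (a i) (Z i)) ∧
    (⨆ i, StanleySpace K (a i) (Z i)) = monomialSpan K I J

/-- The Stanley depth `sdepth_S (I/J)` of the module `I/J`, where `J ⊆ I ⊆ S` are
monomial ideals: the largest `d` such that there is a Stanley decomposition of `I/J`
all of whose Stanley spaces use at least `d` variables.  (As `ℕ∞`: the Stanley depth
of the zero module, which admits the empty decomposition, is `⊤`.)
`sdepth K I ⊥` is `sdepth_S I` and `sdepth K ⊤ I` is `sdepth_S (S/I)`. -/
noncomputable def sdepth (K : Type*) [Field K] {n : ℕ}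
    (I J : Ideal (MvPolynomial (Fin n) K)) : ℕ∞ :=
  sSup {d : ℕ∞ | ∃ (r : ℕ) (a : Fin r → (Fin n →₀ ℕ)) (Z : Fin r → Finset (Fin n)),
    IsStanleyDecomp K I J a Z ∧ ∀ i, d ≤ ((Z i).card : ℕ∞)}

/-- The depth `depth_S M` of an `S`-module `M` with respect to the maximal graded
ideal `(x_0,…,x_{n-1})`: the supremum of the lengths of `M`-regular sequences
contained in that ideal. -/
noncomputable def gradedDepth (K : Type*) [Field K] (n : ℕ) (M : Type*)
    [AddCommGroup M] [Module (MvPolynomial (Fin n) K) M] : ℕ∞ :=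
  sSup {k : ℕ∞ | ∃ rs : List (MvPolynomial (Fin n) K), (rs.length : ℕ∞) = k ∧
    (∀ x ∈ rs, x ∈ Ideal.span (Set.range (X : Fin n → MvPolynomial (Fin n) K))) ∧
    RingTheory.Sequence.IsRegular M rs}

/-- Extension of an ideal along an inclusion of polynomial rings induced by a map
of variables (`IS`, for `f` injective). -/
noncomputable def extIdeal {K : Type*} [Field K] {m n : ℕ} (f : Fin m → Fin n)
    (I : Ideal (MvPolynomial (Fin m) K)) : Ideal (MvPolynomial (Fin n) K) :=
  Ideal.map (rename f : MvPolynomial (Fin m) K →ₐ[K] MvPolynomial (Fin n) K) I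

/-- The inclusion of the variables of `S'' = K[x_{r+1},…,x_n]` into those of
`S = K[x_1,…,x_n]` (variables indexed from `0`). -/
def sndEmbed {n r : ℕ} (h : r ≤ n) : Fin (n - r) → Fin n :=
  fun i => ⟨r + i.1, by have := i.2; omega⟩

/-- The inclusion of the variables of `S'' = K[x_s,…,x_n]` into those of
`S = K[x_1,…,x_n]` (variables indexed from `0`). -/
def midEmbed {n s : ℕ} (hs : 1 ≤ s) (hsn : s ≤ n) : Fin (n + 1 - s) → Fin n :=
  fun i => ⟨s - 1 + i.1, by have := i.2; omega⟩

/-- The exponent vectors of the monomials in the Stanley space `x^a K[Z]`. -/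
def stanleySet {n : ℕ} (a : Fin n →₀ ℕ) (Z : Finset (Fin n)) : Set (Fin n →₀ ℕ) :=
  {w | a ≤ w ∧ ∀ i ∉ Z, w i = a i}

theorem StanleySpace_eq_restrictSupport (K : Type*) [Field K] {n : ℕ} (a : Fin n →₀ ℕ)
    (Z : Finset (Fin n)) : StanleySpace K a Z = restrictSupport K (stanleySet a Z) := by
  rw [StanleySpace, restrictSupport_eq_span]
  congr 1
  ext p
  constructor
  · rintro ⟨c, hc, rfl⟩
    refine ⟨a + c, ⟨le_self_add, fun i hi => ?_⟩, rfl⟩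
    have : c i = 0 := Finsupp.notMem_support_iff.mp fun h => hi (hc h)
    simp [this]
  · rintro ⟨w, ⟨hw, hZ⟩, rfl⟩
    obtain ⟨c, rfl⟩ := le_iff_exists_add.mp hw
    refine ⟨c, fun i hi => ?_, rfl⟩
    by_contra h
    exact Finsupp.mem_support_iff.mp hi (by simpa using hZ i h)

theorem monomialSpan_eq_restrictSupport (K : Type*) [Field K] {n : ℕ}
    (I J : Ideal (MvPolynomial (Fin n) K)) : monomialSpan K I J =
      restrictSupport K {w | monomial w (1 : K) ∈ I ∧ monomial w (1 : K) ∉ J} := by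
  rw [monomialSpan, restrictSupport_eq_span]
  congr 1
  ext p
  constructor
  · rintro ⟨w, rfl, hw⟩
    exact ⟨w, hw, rfl⟩
  · rintro ⟨w, hw, rfl⟩
    exact ⟨w, rfl, hw⟩

theorem restrictSupport_iUnion (K : Type*) [Field K] {σ : Type*} {ι : Sort*}
    (s : ι → Set (σ →₀ ℕ)) :
    restrictSupport K (⋃ i, s i) = ⨆ i, restrictSupport K (s i) := by
  simp_rw [restrictSupport_eq_span, Set.image_iUnion, Submodule.span_iUnion]

theorem disjoint_restrictSupport (K : Type*) [Field K] {σ : Type*} {s t : Set (σ →₀ ℕ)}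
    (h : Disjoint s t) : Disjoint (restrictSupport K s) (restrictSupport K t) := by
  rw [Submodule.disjoint_def]
  intro p hs ht
  rw [mem_restrictSupport_iff] at hs ht
  rw [← support_eq_empty, ← Finset.coe_eq_empty]
  exact Set.subset_empty_iff.mp (h hs ht)

theorem restrictSupport_injective (K : Type*) [Field K] {σ : Type*} :
    Function.Injective (restrictSupport K : Set (σ →₀ ℕ) → _) := by
  intro s t h
  ext w
  simpa using SetLike.ext_iff.mp h (monomial w (1 : K))

theorem IsStanleyDecomp.iUnion_stanleySet {K : Type*} [Field K] {n r : ℕ}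
    {I J : Ideal (MvPolynomial (Fin n) K)} {a : Fin r → (Fin n →₀ ℕ)}
    {Z : Fin r → Finset (Fin n)} (h : IsStanleyDecomp K I J a Z) :
    ⋃ i, stanleySet (a i) (Z i) =
      {w | monomial w (1 : K) ∈ I ∧ monomial w (1 : K) ∉ J} := by
  apply restrictSupport_injective K
  simpa only [restrictSupport_iUnion, ← monomialSpan_eq_restrictSupport,
    ← StanleySpace_eq_restrictSupport] using h.2

theorem isStanleyDecomp_of_partition {K : Type*} [Field K] {n r : ℕ}
    {I J : Ideal (MvPolynomial (Fin n) K)} {a : Fin r → (Fin n →₀ ℕ)}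
    {Z : Fin r → Finset (Fin n)}
    (hd : ∀ i j w, w ∈ stanleySet (a i) (Z i) → w ∈ stanleySet (a j) (Z j) → i = j)
    (hU : ∀ w, (∃ i, w ∈ stanleySet (a i) (Z i)) ↔
      monomial w (1 : K) ∈ I ∧ monomial w (1 : K) ∉ J) :
    IsStanleyDecomp K I J a Z := by
  constructor
  · intro i
    simp only [StanleySpace_eq_restrictSupport, ← restrictSupport_iUnion]
    refine disjoint_restrictSupport K (Set.disjoint_left.mpr fun w hi hw => ?_)
    simp only [Set.mem_iUnion] at hw
    obtain ⟨j, hj, hw⟩ := hw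
    exact hj (hd j i w hw hi)
  · simp only [StanleySpace_eq_restrictSupport, ← restrictSupport_iUnion,
      monomialSpan_eq_restrictSupport]
    congr 1
    ext w
    simpa using hU w

theorem monomial_mem_of_le {K : Type*} [Field K] {σ : Type*} {I : Ideal (MvPolynomial σ K)}
    {v w : σ →₀ ℕ} (hv : monomial v (1 : K) ∈ I) (hvw : v ≤ w) : monomial w (1 : K) ∈ I :=
  I.mem_of_dvd (monomial_one_dvd_monomial_one.mpr hvw) hv

theorem IsStanleyDecomp.exists_card_le {K : Type*} [Field K] {n r : ℕ}
    {I : Ideal (MvPolynomial (Fin n) K)} {a : Fin r → (Fin n →₀ ℕ)}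
    {Z : Fin r → Finset (Fin n)} (h : IsStanleyDecomp K ⊤ I a Z) (hI : I ≠ ⊤)
    {v : Fin n →₀ ℕ} (hv : monomial v (1 : K) ∈ I) : ∃ i, (Z i).card ≤ n - 1 := by
  have h0 : (0 : Fin n →₀ ℕ) ∈ ⋃ i, stanleySet (a i) (Z i) := by
    rw [h.iUnion_stanleySet]
    exact ⟨trivial, fun h => hI (I.eq_top_iff_one.mpr h)⟩
  obtain ⟨i, -⟩ := Set.mem_iUnion.mp h0
  refine ⟨i, ?_⟩
  by_contra! hc
  have hle : (Z i).card ≤ n := by simpa using (Z i).card_le_univ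
  have hZ : Z i = Finset.univ := by
    rw [← Finset.card_eq_iff_eq_univ, Fintype.card_fin]
    omega
  have hmem : a i + v ∈ ⋃ i, stanleySet (a i) (Z i) :=
    Set.mem_iUnion.mpr ⟨i, le_self_add, by simp [hZ]⟩
  rw [h.iUnion_stanleySet] at hmem
  exact hmem.2 (monomial_mem_of_le hv le_add_self)

/-- If every Stanley space of a decomposition of `S/I` misses at most one variable, then the
exponent vectors of monomials in `I` are closed under infima. -/
theorem IsStanleyDecomp.monomial_inf_mem {K : Type*} [Field K] {n r : ℕ}
    {I : Ideal (MvPolynomial (Fin n) K)} {a : Fin r → (Fin n →₀ ℕ)}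
    {Z : Fin r → Finset (Fin n)} (h : IsStanleyDecomp K ⊤ I a Z)
    (hc : ∀ i, n - 1 ≤ (Z i).card) {u v : Fin n →₀ ℕ} (hu : monomial u (1 : K) ∈ I)
    (hv : monomial v (1 : K) ∈ I) : monomial (u ⊓ v) (1 : K) ∈ I := by
  by_contra hw
  have hmem : u ⊓ v ∈ ⋃ i, stanleySet (a i) (Z i) := by
    rw [h.iUnion_stanleySet]
    exact ⟨trivial, hw⟩
  obtain ⟨i, hle, hi⟩ := Set.mem_iUnion.mp hmem
  have hnot : ∀ w, monomial w (1 : K) ∈ I → w ∉ stanleySet (a i) (Z i) := by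
    intro w hwI hwi
    have : w ∈ ⋃ i, stanleySet (a i) (Z i) := Set.mem_iUnion.mpr ⟨i, hwi⟩
    rw [h.iUnion_stanleySet] at this
    exact this.2 hwI
  have hcompl : (Z i)ᶜ.card ≤ 1 := by
    rw [Finset.card_compl, Fintype.card_fin]
    have := hc i
    omega
  have hex : ∀ w, monomial w (1 : K) ∈ I → u ⊓ v ≤ w → ∃ j ∉ Z i, w j ≠ a i j := by
    intro w hwI hwle
    by_contra! hj
    exact hnot w hwI ⟨hle.trans hwle, hj⟩
  obtain ⟨j, hj, huj⟩ := hex u hu inf_le_left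
  obtain ⟨k, hk, hvk⟩ := hex v hv inf_le_right
  obtain rfl : j = k := Finset.card_le_one.mp hcompl j (by simpa) k (by simpa)
  have := hi j hj
  rw [Finsupp.inf_apply] at this
  rcases min_choice (u j) (v j) with hm | hm <;> omega

theorem IsMonomialIdeal.isPrincipal_of_inf_mem {K : Type*} [Field K] {n : ℕ}
    {I : Ideal (MvPolynomial (Fin n) K)} (hI : IsMonomialIdeal I)
    (hinf : ∀ u v, monomial u (1 : K) ∈ I → monomial v (1 : K) ∈ I →
      monomial (u ⊓ v) (1 : K) ∈ I)
    {v : Fin n →₀ ℕ} (hv : monomial v (1 : K) ∈ I) : I.IsPrincipal := by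
  obtain ⟨b, hb, hmin⟩ := (wellFounded_lt (α := Fin n →₀ ℕ)).has_min
    {w | monomial w (1 : K) ∈ I} ⟨v, hv⟩
  have hle : ∀ w, monomial w (1 : K) ∈ I → b ≤ w := by
    intro w hw
    by_contra h
    exact hmin _ (hinf b w hb hw) (inf_lt_left.mpr h)
  refine ⟨monomial b 1, le_antisymm ?_ ?_⟩
  · obtain ⟨G, hG⟩ := hI
    have hGI : ∀ g ∈ G, monomial g (1 : K) ∈ I := fun g hg =>
      hG ▸ Ideal.subset_span ⟨g, hg, rfl⟩
    conv_lhs => rw [hG]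
    rw [Ideal.span_le]
    rintro _ ⟨g, hg, rfl⟩
    exact Ideal.mem_span_singleton.mpr
      (monomial_one_dvd_monomial_one.mpr (hle g (hGI g hg)))
  · exact (Ideal.span_singleton_le_iff_mem I).mpr hb

theorem IsMonomialIdeal.exists_monomial_mem {K : Type*} [Field K] {n : ℕ}
    {I : Ideal (MvPolynomial (Fin n) K)} (hI : IsMonomialIdeal I) (h0 : I ≠ ⊥) :
    ∃ v, monomial v (1 : K) ∈ I := by
  obtain ⟨G, rfl⟩ := hI
  obtain ⟨g, hg⟩ : G.Nonempty := by
    rw [Set.nonempty_iff_ne_empty]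
    rintro rfl
    simp at h0
  exact ⟨g, Ideal.subset_span ⟨g, hg, rfl⟩⟩

/-- The corner of a piece of the standard decomposition of the complement of `{w | b ≤ w}`:
it agrees with `b` before `i`, equals `k` at `i` and vanishes after `i`. -/
noncomputable def truncateUpdate {n : ℕ} (b : Fin n →₀ ℕ) (i : Fin n) (k : ℕ) : Fin n →₀ ℕ :=
  Finsupp.equivFunOnFinite.symm fun j => if j < i then b j else if j = i then k else 0

theorem mem_stanleySet_truncateUpdate {n : ℕ} {b w : Fin n →₀ ℕ} {i : Fin n} {k : ℕ} :
    w ∈ stanleySet (truncateUpdate b i k) {i}ᶜ ↔ (∀ j < i, b j ≤ w j) ∧ w i = k := by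
  simp only [stanleySet, truncateUpdate, Set.mem_ofPred_eq, Finsupp.le_def,
    Finsupp.equivFunOnFinite_symm_apply_apply]
  constructor
  · rintro ⟨h1, h2⟩
    exact ⟨fun j hj => by simpa [hj] using h1 j, by simpa using h2 i (by simp)⟩
  · rintro ⟨h1, rfl⟩
    refine ⟨fun j => ?_, fun j hj => ?_⟩
    · split_ifs with h h'
      · exact h1 j h
      · rw [h']
      · exact Nat.zero_le _
    · obtain rfl : j = i := by simpa using hj
      simp

theorem exists_isStanleyDecomp_of_mem_iff_le {K : Type*} [Field K] {n : ℕ}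
    {I : Ideal (MvPolynomial (Fin n) K)} {b : Fin n →₀ ℕ}
    (hb : ∀ w, monomial w (1 : K) ∈ I ↔ b ≤ w) :
    ∃ (r : ℕ) (a : Fin r → (Fin n →₀ ℕ)) (Z : Fin r → Finset (Fin n)),
      IsStanleyDecomp K ⊤ I a Z ∧ ∀ i, (Z i).card = n - 1 := by
  let e := Fintype.equivFin (Σ i : Fin n, Fin (b i))
  refine ⟨_, fun s => truncateUpdate b (e.symm s).1 (e.symm s).2, fun s => {(e.symm s).1}ᶜ,
    isStanleyDecomp_of_partition ?_ ?_, fun s => by simp [Finset.card_compl]⟩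
  · intro s t w hs ht
    rw [mem_stanleySet_truncateUpdate] at hs ht
    apply e.symm.injective
    generalize e.symm s = p at hs ⊢
    generalize e.symm t = q at ht ⊢
    obtain ⟨i, k, hk⟩ := p
    obtain ⟨j, l, hl⟩ := q
    dsimp only at hs ht
    obtain ⟨hs, rfl⟩ := hs
    obtain ⟨ht, rfl⟩ := ht
    obtain rfl : i = j := by
      rcases lt_trichotomy i j with h | h | h
      · exact absurd (ht i h) (by omega)
      · exact h
      · exact absurd (hs j h) (by omega)
    rfl
  · intro w
    simp only [mem_stanleySet_truncateUpdate, Submodule.mem_top,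
      true_and, hb, Finsupp.le_def, not_forall, not_le]
    constructor
    · rintro ⟨s, -, hs⟩
      exact ⟨(e.symm s).1, hs ▸ (e.symm s).2.2⟩
    · intro h
      obtain ⟨i, hi, hmin⟩ := wellFounded_lt.has_min {i | w i < b i} h
      refine ⟨e ⟨i, w i, hi⟩, ?_⟩
      rw [Equiv.symm_apply_apply]
      exact ⟨fun j hj => not_lt.mp fun hlt => hmin j hlt hj, rfl⟩

theorem exists_monomial_mem_iff_le_of_isPrincipal {K : Type*} [Field K] {n : ℕ}
    {I : Ideal (MvPolynomial (Fin n) K)} (hI : I.IsPrincipal) {v : Fin n →₀ ℕ}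
    (hv : monomial v (1 : K) ∈ I) : ∃ b, ∀ w, monomial w (1 : K) ∈ I ↔ b ≤ w := by
  obtain ⟨f, hf⟩ := hI
  change I = Ideal.span {f} at hf
  rw [hf, Ideal.mem_span_singleton, dvd_monomial_one_iff_exists] at hv
  obtain ⟨b, u, -, hu, rfl⟩ := hv
  refine ⟨b, fun w => ?_⟩
  rw [hf, Ideal.mem_span_singleton, monomial_dvd_monomial]
  simp [hu.ne_zero]

/-- Let `I ⊂ S = K[x_1,…,x_n]` be a nonzero proper monomial ideal.
Then `sdepth_S(S/I) = n - 1` if and only if `I` is principal. -/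
theorem sdepth_quot_eq_sub_one_iff_principal {K : Type*} [Field K] {n : ℕ}
    (I : Ideal (MvPolynomial (Fin n) K))
    (hmI : IsMonomialIdeal I) (hI0 : I ≠ ⊥) (hI1 : I ≠ ⊤) :
    sdepth K ⊤ I = ((n - 1 : ℕ) : ℕ∞) ↔ I.IsPrincipal := by
  obtain ⟨v, hv⟩ := hmI.exists_monomial_mem hI0
  constructor
  · intro h
    refine hmI.isPrincipal_of_inf_mem (fun u v hu hv => ?_) hv
    by_cases hn : n ≤ 1
    · have : Subsingleton (Fin n) := Fin.subsingleton_iff_le_one.mpr hn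
      have huv : u ≤ v ∨ v ≤ u := by
        by_contra! hlt
        simp only [Finsupp.le_def, not_forall] at hlt
        obtain ⟨⟨i, hi⟩, ⟨j, hj⟩⟩ := hlt
        obtain rfl := Subsingleton.elim i j
        omega
      rcases huv with huv | huv
      · rwa [inf_eq_left.mpr huv]
      · rwa [inf_eq_right.mpr huv]
    · have hlt : ((n - 2 : ℕ) : ℕ∞) < sdepth K ⊤ I := by
        rw [h, Nat.cast_lt]
        omega
      obtain ⟨d, ⟨r, a, Z, hdec, hd⟩, hnd⟩ := lt_sSup_iff.mp hlt
      refine hdec.monomial_inf_mem (fun i => ?_) hu hv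
      have := Nat.cast_lt.mp (hnd.trans_le (hd i))
      omega
  · intro hP
    apply le_antisymm
    · refine sSup_le ?_
      rintro d ⟨r, a, Z, hdec, hd⟩
      obtain ⟨i, hi⟩ := hdec.exists_card_le hI1 hv
      exact (hd i).trans (Nat.cast_le.mpr hi)
    · obtain ⟨b, hb⟩ := exists_monomial_mem_iff_le_of_isPrincipal hP hv
      obtain ⟨r, a, Z, hdec, hZ⟩ := exists_isStanleyDecomp_of_mem_iff_le hb
      exact le_sSup ⟨r, a, Z, hdec, fun i => by rw [hZ i]⟩
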